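/- arXiv:2206.00090 — 7 statements merged into one kernel-verified Lean document; each statement's English description precedes it below -/
import Mathlib

section
/- Let n ≥ 1 and for i = 1,…,n let f_i : ℝ^d → ℝ be differentiable, μ_{x,i}-strongly convex and L_{x,i}-smooth with 0 ≤ μ_{x,i} ≤ L_{x,i}. Set L_g = (1/n)∑_i L_{x,i}, μ_g = (1/n)∑_i μ_{x,i}, L_l = max_i L_{x,i}, μ_l = min_i μ_{x,i}, and assume μ_g > 0. Let f(x) = (1/n)∑_i f_i(x). Let x_1,…,x_n ∈ ℝ^d, let x̄ = (1/n)∑_i x_i, and suppose ∑_{i=1}^n ‖x_i − x̄‖² ≤ δ′ for some δ′ ≥ 0. Define δ = (1/(2n))(L_l²/L_g + 2L_l²/μ_g + L_l − μ_l)·δ′, c = (1/n)( ∑_i [ f_i(x_i) + ⟨∇f_i(x_i), x̄ − x_i⟩ ] + (1/2)(μ_l − 2L_l²/μ_g) ∑_i ‖x̄ − x_i‖² ), and s = (1/n)∑_i ∇f_i(x_i). Then (c, s) is a (δ, 2L_g, μ_g/2)-model of f at x̄. -/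
open MeasureTheory ProbabilityTheory ContinuousLinearMap
open scoped RealInnerProductSpace BigOperators

noncomputable section

/-- `(c, s)` is a `(δ, L, μ)`-model of `h` at `x`. -/
def IsModel {d : ℕ} (h : EuclideanSpace ℝ (Fin d) → ℝ) (x : EuclideanSpace ℝ (Fin d))
    (δ L μ : ℝ) (c : ℝ) (s : EuclideanSpace ℝ (Fin d)) : Prop :=
  ∀ y : EuclideanSpace ℝ (Fin d),
    μ / 2 * ‖y - x‖ ^ 2 ≤ h y - c - ⟪s, y - x⟫ ∧
    h y - c - ⟪s, y - x⟫ ≤ L / 2 * ‖y - x‖ ^ 2 + δ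

/-- **Descent lemma**: a function whose gradient is `L`-Lipschitz lies below the quadratic
with curvature `L` tangent to it at `x`. -/
theorem le_add_inner_gradient_add_sq {E : Type*} [NormedAddCommGroup E] [InnerProductSpace ℝ E]
    [CompleteSpace E] {h : E → ℝ} {L : ℝ} (hd : ∀ x, DifferentiableAt ℝ h x)
    (hL : ∀ x y, ‖gradient h y - gradient h x‖ ≤ L * ‖y - x‖) (x y : E) :
    h y ≤ h x + ⟪gradient h x, y - x⟫ + L / 2 * ‖y - x‖ ^ 2 := by
  set v := y - x with hv
  let φ : ℝ → ℝ := fun t =>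
    h (x + t • v) - t * ⟪gradient h x, v⟫ - L / 2 * ‖v‖ ^ 2 * t ^ 2
  have hφ : ∀ t, HasDerivAt φ
      (⟪gradient h (x + t • v) - gradient h x, v⟫ - L * ‖v‖ ^ 2 * t) t := by
    intro t
    have hline : HasDerivAt (fun t : ℝ => x + t • v) v t := by
      simpa using ((hasDerivAt_id t).smul_const v).const_add x
    have hcomp : HasDerivAt (fun t : ℝ => h (x + t • v)) ⟪gradient h (x + t • v), v⟫ t := by
      rw [inner_gradient_left]
      exact (hd (x + t • v)).hasFDerivAt.comp_hasDerivAt t hline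
    refine ((hcomp.sub ((hasDerivAt_id t).mul_const ⟪gradient h x, v⟫)).sub
      ((hasDerivAt_pow 2 t).const_mul (L / 2 * ‖v‖ ^ 2))).congr_deriv ?_
    rw [inner_sub_left]
    push_cast
    ring
  have hanti : AntitoneOn φ (Set.Icc 0 1) := by
    refine antitoneOn_of_deriv_nonpos (convex_Icc 0 1)
      (fun t _ => (hφ t).continuousAt.continuousWithinAt)
      (fun t _ => (hφ t).differentiableAt.differentiableWithinAt) fun t ht => ?_
    rw [interior_Icc] at ht
    rw [(hφ t).deriv]
    have hlip := hL x (x + t • v)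
    rw [add_sub_cancel_left, norm_smul, Real.norm_of_nonneg ht.1.le] at hlip
    calc _ ≤ ‖gradient h (x + t • v) - gradient h x‖ * ‖v‖ - L * ‖v‖ ^ 2 * t := by
          gcongr
          exact real_inner_le_norm _ _
      _ ≤ L * (t * ‖v‖) * ‖v‖ - L * ‖v‖ ^ 2 * t := by gcongr
      _ = 0 := by ring
  have h01 := hanti (Set.left_mem_Icc.2 zero_le_one) (Set.right_mem_Icc.2 zero_le_one) zero_le_one
  simp only [φ, one_smul, zero_smul, add_zero, hv, add_sub_cancel] at h01
  linarith

/-- Young's inequality with weight `m`, for an inner product scaled by a factor in `[0, K]`. -/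
theorem abs_mul_inner_le_add_sq {E : Type*} [NormedAddCommGroup E] [InnerProductSpace ℝ E]
    {k K m : ℝ} (hk : 0 ≤ k) (hkK : k ≤ K) (hm : 0 < m) (u v : E) :
    |k * ⟪u, v⟫| ≤ m / 2 * ‖u‖ ^ 2 + K ^ 2 / (2 * m) * ‖v‖ ^ 2 := by
  calc |k * ⟪u, v⟫| ≤ K * (‖u‖ * ‖v‖) := by
        rw [abs_mul, abs_of_nonneg hk]
        gcongr
        · exact hk.trans hkK
        · exact abs_real_inner_le_norm u v
    _ ≤ m / 2 * ‖u‖ ^ 2 + K ^ 2 / (2 * m) * ‖v‖ ^ 2 := by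
        have hsq : m / 2 * ‖u‖ ^ 2 + K ^ 2 / (2 * m) * ‖v‖ ^ 2 - K * (‖u‖ * ‖v‖)
            = (m * ‖u‖ - K * ‖v‖) ^ 2 / (2 * m) := by
          field_simp
          ring
        have : 0 ≤ (m * ‖u‖ - K * ‖v‖) ^ 2 / (2 * m) := by positivity
        linarith

theorem stmt0 {d n : ℕ} (hn : 1 ≤ n)
    (f : Fin n → EuclideanSpace ℝ (Fin d) → ℝ)
    (μx Lx : Fin n → ℝ)
    (hdiff : ∀ i x, DifferentiableAt ℝ (f i) x)
    (hμ0 : ∀ i, 0 ≤ μx i) (hμL : ∀ i, μx i ≤ Lx i)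
    (hsmooth : ∀ i x y, ‖gradient (f i) y - gradient (f i) x‖ ≤ Lx i * ‖y - x‖)
    (hsc : ∀ i x y, f i y ≥ f i x + ⟪gradient (f i) x, y - x⟫ + μx i / 2 * ‖y - x‖ ^ 2)
    (Lg μg Ll μl : ℝ)
    (hLg : Lg = (n : ℝ)⁻¹ * ∑ i, Lx i)
    (hμg : μg = (n : ℝ)⁻¹ * ∑ i, μx i)
    (hLl : IsGreatest (Set.range Lx) Ll)
    (hμl : IsLeast (Set.range μx) μl)
    (hμgpos : 0 < μg)
    (x : Fin n → EuclideanSpace ℝ (Fin d))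
    (xbar : EuclideanSpace ℝ (Fin d)) (hxbar : xbar = (n : ℝ)⁻¹ • ∑ i, x i)
    (δ' : ℝ) (hδ'0 : 0 ≤ δ') (hδ' : ∑ i, ‖x i - xbar‖ ^ 2 ≤ δ')
    (δ c : ℝ) (s : EuclideanSpace ℝ (Fin d))
    (hδ : δ = 1 / (2 * n) * (Ll ^ 2 / Lg + 2 * Ll ^ 2 / μg + Ll - μl) * δ')
    (hc : c = (n : ℝ)⁻¹ * ((∑ i, (f i (x i) + ⟪gradient (f i) (x i), xbar - x i⟫))
          + 1 / 2 * (μl - 2 * Ll ^ 2 / μg) * ∑ i, ‖xbar - x i‖ ^ 2))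
    (hs : s = (n : ℝ)⁻¹ • ∑ i, gradient (f i) (x i)) :
    IsModel (fun z => (n : ℝ)⁻¹ * ∑ i, f i z) xbar δ (2 * Lg) (μg / 2) c s := by
  have hn0 : (0 : ℝ) < n := by exact_mod_cast hn
  have hLle : ∀ i, Lx i ≤ Ll := fun i => hLl.2 ⟨i, rfl⟩
  have hμle : ∀ i, μl ≤ μx i := fun i => hμl.2 ⟨i, rfl⟩
  have hL0 : ∀ i, 0 ≤ Lx i := fun i => (hμ0 i).trans (hμL i)
  have hLgpos : 0 < Lg := by
    refine hμgpos.trans_le ?_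
    rw [hμg, hLg]
    gcongr with i
    exact hμL i
  have hμlLl : μl ≤ Ll := (hμle ⟨0, hn⟩).trans ((hμL _).trans (hLle _))
  have hsumμ : ∑ i, μx i = n * μg := by rw [hμg]; field_simp
  have hsumL : ∑ i, Lx i = n * Lg := by rw [hLg]; field_simp
  intro y
  set D := y - xbar
  have hsplit : ∀ i, y - x i = D + (xbar - x i) := fun i => (sub_add_sub_cancel _ _ _).symm
  have hnorm : ∀ i, ‖y - x i‖ ^ 2
      = ‖D‖ ^ 2 + 2 * ⟪D, xbar - x i⟫ + ‖xbar - x i‖ ^ 2 := fun i => by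
    rw [hsplit, norm_add_sq_real]
  have hinner : ∀ i, ⟪gradient (f i) (x i), y - x i⟫
      = ⟪gradient (f i) (x i), D⟫ + ⟪gradient (f i) (x i), xbar - x i⟫ := fun i => by
    rw [hsplit, inner_add_right]
  set κ := μl - 2 * Ll ^ 2 / μg with hκ
  have hgap : (n : ℝ)⁻¹ * ∑ i, f i y - c - ⟪s, D⟫
      = (n : ℝ)⁻¹ * ∑ i, (f i y - f i (x i) - ⟪gradient (f i) (x i), y - x i⟫
          - 1 / 2 * κ * ‖xbar - x i‖ ^ 2) := by
    rw [hc, hs, real_inner_smul_left, sum_inner]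
    simp only [hinner, Finset.sum_sub_distrib, Finset.sum_add_distrib, ← Finset.mul_sum]
    ring
  have hlower : ∀ i, μx i / 2 * ‖D‖ ^ 2 - μg / 4 * ‖D‖ ^ 2
      ≤ f i y - f i (x i) - ⟪gradient (f i) (x i), y - x i⟫
        - 1 / 2 * κ * ‖xbar - x i‖ ^ 2 := fun i => by
    have h1 := hsc i (x i) y
    have h2 := neg_le_of_abs_le (abs_mul_inner_le_add_sq (hμ0 i) ((hμL i).trans (hLle i))
      (half_pos hμgpos) D (xbar - x i))
    have h3 := mul_le_mul_of_nonneg_right (hμle i) (sq_nonneg ‖xbar - x i‖)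
    have h4 : Ll ^ 2 / (2 * (μg / 2)) = Ll ^ 2 / μg := by congr 1; ring
    rw [h4] at h2
    rw [hnorm] at h1
    rw [hκ, mul_div_assoc]
    linarith
  have hupper : ∀ i, f i y - f i (x i) - ⟪gradient (f i) (x i), y - x i⟫
        - 1 / 2 * κ * ‖xbar - x i‖ ^ 2
      ≤ Lx i / 2 * ‖D‖ ^ 2 + Lg / 2 * ‖D‖ ^ 2
        + 1 / 2 * (Ll ^ 2 / Lg + 2 * Ll ^ 2 / μg + Ll - μl) * ‖x i - xbar‖ ^ 2 := fun i => by
    have h1 := le_add_inner_gradient_add_sq (hdiff i) (hsmooth i) (x i) y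
    have h2 := le_of_abs_le (abs_mul_inner_le_add_sq (hL0 i) (hLle i) hLgpos D (xbar - x i))
    have h3 := mul_le_mul_of_nonneg_right (hLle i) (sq_nonneg ‖xbar - x i‖)
    have h4 : Ll ^ 2 / (2 * Lg) = 1 / 2 * (Ll ^ 2 / Lg) := by field_simp
    rw [h4] at h2
    rw [hnorm] at h1
    rw [hκ, norm_sub_rev (x i)]
    linarith
  change μg / 2 / 2 * ‖D‖ ^ 2 ≤ (n : ℝ)⁻¹ * ∑ i, f i y - c - ⟪s, D⟫ ∧
    (n : ℝ)⁻¹ * ∑ i, f i y - c - ⟪s, D⟫ ≤ 2 * Lg / 2 * ‖D‖ ^ 2 + δ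
  rw [hgap]
  constructor
  · calc μg / 2 / 2 * ‖D‖ ^ 2
        = (n : ℝ)⁻¹ * ∑ i, (μx i / 2 * ‖D‖ ^ 2 - μg / 4 * ‖D‖ ^ 2) := by
          rw [Finset.sum_sub_distrib, ← Finset.sum_mul, ← Finset.sum_div, hsumμ,
            Finset.sum_const, Finset.card_univ, Fintype.card_fin, nsmul_eq_mul]
          field_simp
          ring
      _ ≤ _ := by
          refine mul_le_mul_of_nonneg_left (Finset.sum_le_sum fun i _ => hlower i) ?_
          positivity
  · set C := Ll ^ 2 / Lg + 2 * Ll ^ 2 / μg + Ll - μl with hC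
    have hC0 : 0 ≤ C := by
      have : 0 ≤ Ll ^ 2 / Lg + 2 * Ll ^ 2 / μg := by positivity
      linarith
    calc _ ≤ (n : ℝ)⁻¹ * ∑ i, (Lx i / 2 * ‖D‖ ^ 2 + Lg / 2 * ‖D‖ ^ 2
          + 1 / 2 * C * ‖x i - xbar‖ ^ 2) := by
          gcongr with i
          exact hupper i
      _ = 2 * Lg / 2 * ‖D‖ ^ 2 + 1 / (2 * n) * C * ∑ i, ‖x i - xbar‖ ^ 2 := by
          rw [Finset.sum_add_distrib, Finset.sum_add_distrib, ← Finset.sum_mul,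
            ← Finset.sum_div, hsumL, Finset.sum_const, Finset.card_univ, Fintype.card_fin,
            nsmul_eq_mul, ← Finset.mul_sum]
          field_simp
          ring
      _ ≤ 2 * Lg / 2 * ‖D‖ ^ 2 + δ := by
          rw [hδ]
          gcongr

end
end

section
/- Let g : ℝ^d → ℝ be convex and differentiable, let y, y* ∈ ℝ^d, L > 0, δ ≥ 0, and let (c, s) ∈ ℝ × ℝ^d satisfy 0 ≤ g(z) − c − ⟨s, z − y⟩ ≤ (L/2)‖z − y‖² + δ for all z ∈ ℝ^d. Then (1/(2L))‖s − ∇g(y*)‖² ≤ g(y) − g(y*) − ⟨∇g(y*), y − y*⟩ + δ, i.e., (1/(2L))‖s − ∇g(y*)‖² ≤ B_g(y, y*) + δ. -/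
open scoped RealInnerProductSpace

noncomputable section

/-- First-order characterization of convexity: a convex function lies above its tangent planes. -/
theorem ConvexOn.add_inner_gradient_le {E : Type*} [NormedAddCommGroup E] [InnerProductSpace ℝ E]
    [CompleteSpace E] {g : E → ℝ} (hg : ConvexOn ℝ Set.univ g) {x : E}
    (hx : DifferentiableAt ℝ g x) (z : E) :
    g x + ⟪gradient g x, z - x⟫ ≤ g z := by
  have hconv : ConvexOn ℝ Set.univ (g ∘ AffineMap.lineMap (k := ℝ) x z) :=
    hg.comp_affineMap (AffineMap.lineMap x z)
  have hderiv : HasDerivAt (g ∘ AffineMap.lineMap (k := ℝ) x z) ⟪gradient g x, z - x⟫ 0 := by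
    have hfderiv : HasFDerivAt g (InnerProductSpace.toDual ℝ E (gradient g x))
        (AffineMap.lineMap x z (0 : ℝ)) := by
      simpa using hx.hasGradientAt.hasFDerivAt
    simpa using hfderiv.comp_hasDerivAt (0 : ℝ) AffineMap.hasDerivAt_lineMap
  have hslope := hconv.le_slope_of_hasDerivAt (Set.mem_univ 0) (Set.mem_univ 1) zero_lt_one hderiv
  simp only [slope_def_field, Function.comp_apply, AffineMap.lineMap_apply_one,
    AffineMap.lineMap_apply_zero, sub_zero, div_one] at hslope
  linarith

theorem stmt2 {d : ℕ} (g : EuclideanSpace ℝ (Fin d) → ℝ)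
    (hgconv : ConvexOn ℝ Set.univ g)
    (hgdiff : ∀ z, DifferentiableAt ℝ g z)
    (y ystar : EuclideanSpace ℝ (Fin d))
    (L δ : ℝ) (hL : 0 < L) (hδ : 0 ≤ δ)
    (c : ℝ) (s : EuclideanSpace ℝ (Fin d))
    (hmodel : ∀ z : EuclideanSpace ℝ (Fin d),
      0 ≤ g z - c - ⟪s, z - y⟫ ∧ g z - c - ⟪s, z - y⟫ ≤ L / 2 * ‖z - y‖ ^ 2 + δ) :
    1 / (2 * L) * ‖s - gradient g ystar‖ ^ 2
      ≤ g y - g ystar - ⟪gradient g ystar, y - ystar⟫ + δ := by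
  set v := gradient g ystar with hv
  have hc : c ≤ g y := by simpa using (hmodel y).1
  set z := y - (1 / L) • (s - v) with hz
  have hzy : z - y = -((1 / L) • (s - v)) := by rw [hz]; abel
  have hlower := hgconv.add_inner_gradient_le (hgdiff ystar) z
  have hupper := (hmodel z).2
  have hsplit : z - ystar = (z - y) + (y - ystar) := by abel
  rw [← hv, hsplit, inner_add_right, hzy, inner_neg_right, inner_smul_right] at hlower
  rw [hzy, inner_neg_right, inner_smul_right, norm_neg, norm_smul, mul_pow, Real.norm_eq_abs,
    sq_abs] at hupper
  have hsq : ⟪s, s - v⟫ - ⟪v, s - v⟫ = ‖s - v‖ ^ 2 := by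
    rw [← inner_sub_left, real_inner_self_eq_norm_sq]
  have hquad : L / 2 * ((1 / L) ^ 2 * ‖s - v‖ ^ 2) = 1 / (2 * L) * ‖s - v‖ ^ 2 := by
    field_simp
  have hlin : 1 / L * ⟪s, s - v⟫ - 1 / L * ⟪v, s - v⟫ = 2 * (1 / (2 * L) * ‖s - v‖ ^ 2) := by
    rw [← mul_sub, hsq]; field_simp
  linarith

end
end

section
/- Let f : ℝ^d → ℝ be differentiable, let x_g, x_f, x* ∈ ℝ^d, L > 0, δ ≥ 0, and let (c, s) ∈ ℝ × ℝ^d satisfy 0 ≤ f(z) − c − ⟨s, z − x_g⟩ ≤ (L/2)‖z − x_g‖² + δ for all z ∈ ℝ^d. Then ⟨s − ∇f(x*), x_f − x_g⟩ ≥ B_f(x_f, x*) − B_f(x_g, x*) − (L/2)‖x_f − x_g‖² − δ. -/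
open scoped RealInnerProductSpace

noncomputable section

/-- Bregman divergence of a differentiable function. -/
def breg {d : ℕ} (h : EuclideanSpace ℝ (Fin d) → ℝ)
    (u v : EuclideanSpace ℝ (Fin d)) : ℝ :=
  h u - h v - ⟪gradient h v, u - v⟫

theorem stmt5 {d : ℕ} (f : EuclideanSpace ℝ (Fin d) → ℝ)
    (hfdiff : ∀ z, DifferentiableAt ℝ f z)
    (xg xf xstar : EuclideanSpace ℝ (Fin d))
    (L δ : ℝ) (hL : 0 < L) (hδ : 0 ≤ δ)
    (c : ℝ) (s : EuclideanSpace ℝ (Fin d))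
    (hmodel : ∀ z : EuclideanSpace ℝ (Fin d),
      0 ≤ f z - c - ⟪s, z - xg⟫ ∧ f z - c - ⟪s, z - xg⟫ ≤ L / 2 * ‖z - xg‖ ^ 2 + δ) :
    ⟪s - gradient f xstar, xf - xg⟫
      ≥ breg f xf xstar - breg f xg xstar - L / 2 * ‖xf - xg‖ ^ 2 - δ := by
  have hlower := (hmodel xg).1
  have hupper := (hmodel xf).2
  simp only [sub_self, inner_zero_right] at hlower
  simp only [breg, inner_sub_left, inner_sub_right] at hupper ⊢
  linarith

end
end

section
/- Let f : ℝ^d → ℝ be differentiable, let x_g, x* ∈ ℝ^d, L > 0, μ ≥ 0, δ ≥ 0, and let (c, s) be a (δ, L, μ)-model of f at x_g. Then 2⟨s − ∇f(x*), x_g − x*⟩ ≥ 2 B_f(x_g, x*) + μ‖x_g − x*‖² − 2δ. -/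
open scoped RealInnerProductSpace

noncomputable section

theorem stmt6 {d : ℕ} (f : EuclideanSpace ℝ (Fin d) → ℝ)
    (hfdiff : ∀ z, DifferentiableAt ℝ f z)
    (xg xstar : EuclideanSpace ℝ (Fin d))
    (L μ δ : ℝ) (hL : 0 < L) (hμ : 0 ≤ μ) (hδ : 0 ≤ δ)
    (c : ℝ) (s : EuclideanSpace ℝ (Fin d))
    (hmodel : IsModel f xg δ L μ c s) :
    2 * ⟪s - gradient f xstar, xg - xstar⟫
      ≥ 2 * breg f xg xstar + μ * ‖xg - xstar‖ ^ 2 - 2 * δ := by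
  have upper := (hmodel xg).2
  have lower := (hmodel xstar).1
  rw [sub_self, inner_zero_right, norm_zero] at upper
  rw [norm_sub_rev, ← neg_sub xg xstar, inner_neg_right] at lower
  rw [breg, inner_sub_left]
  linarith

end
end

section
/- Let f : ℝ^d → ℝ be differentiable, let x_g, x_f, x* ∈ ℝ^d, L > 0, μ ≥ 0, δ ≥ 0, and let (c, s) be a (δ, L, μ)-model of f at x_g. Then ⟨s − ∇f(x*), x_f − x_g⟩ ≤ B_f(x_f, x*) − B_f(x_g, x*) + δ. -/
open scoped RealInnerProductSpace

noncomputable section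

theorem stmt7 {d : ℕ} (f : EuclideanSpace ℝ (Fin d) → ℝ)
    (hfdiff : ∀ z, DifferentiableAt ℝ f z)
    (xg xf xstar : EuclideanSpace ℝ (Fin d))
    (L μ δ : ℝ) (hL : 0 < L) (hμ : 0 ≤ μ) (hδ : 0 ≤ δ)
    (c : ℝ) (s : EuclideanSpace ℝ (Fin d))
    (hmodel : IsModel f xg δ L μ c s) :
    ⟪s - gradient f xstar, xf - xg⟫
      ≤ breg f xf xstar - breg f xg xstar + δ := by
  have hg := (hmodel xg).2
  have hf := (hmodel xf).1
  have hμf : 0 ≤ μ / 2 * ‖xf - xg‖ ^ 2 := by positivity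
  simp only [sub_self, inner_zero_right, norm_zero] at hg
  simp only [breg, inner_sub_left, inner_sub_right] at hf ⊢
  linarith

end
end

section
/- (Convergence of deterministic inexact APDG, Theorem 2 of the paper in the strongly-convex–strongly-concave regime.) Let f : ℝ^{d_x} → ℝ be μ_x-strongly convex and L_x-smooth and g : ℝ^{d_y} → ℝ be μ_y-strongly convex and L_y-smooth, with 0 < μ_x ≤ L_x and 0 < μ_y ≤ L_y; let A be a d_y × d_x real matrix with ‖A v‖ ≤ L_{xy}‖v‖ for all v, L_{xy} > 0, and let (x*, y*) satisfy ∇f(x*) + Aᵀ y* = 0 and ∇g(y*) = A x*. Suppose c_f : ℝ^{d_x} → ℝ, s_f : ℝ^{d_x} → ℝ^{d_x}, c_g : ℝ^{d_y} → ℝ, s_g : ℝ^{d_y} → ℝ^{d_y} are such that for every x, (c_f(x), s_f(x)) is a (δ_x, L_x, μ_x)-model of f at x, and for every y, (c_g(y), s_g(y)) is a (δ_y, L_y, μ_y)-model of g at y, where δ_x, δ_y ≥ 0. Set ω = √(μ_y/μ_x), σ_x = √(μ_x/(2L_x)), σ_y = √(μ_y/(2L_y)), τ_x = (σ_x⁻¹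 + 1/2)⁻¹, τ_y = (σ_y⁻¹ + 1/2)⁻¹, α_x = μ_x, α_y = μ_y, η_x = min{ 1/(4(μ_x + L_x σ_x)), ω/(4L_{xy}) }, η_y = min{ 1/(4(μ_y + L_y σ_y)), 1/(4L_{xy} ω) }, β_x = min{ 1/(2L_y), 1/(2 η_x L_{xy}²) }, β_y = min{ 1/(2L_x), 1/(2 η_y L_{xy}²) }, θ = 1 − [ max{ 4(μ_x + L_x σ_x)/μ_x, 2/σ_x, 4(μ_y + L_y σ_y)/μ_y, 2/σ_y, 4L_{xy}/(μ_x ω), 4L_{xy} ω/μ_y } ]⁻¹. Define sequences by x_f^0 = x^0 ∈ ℝ^{d_x}, y_f^0 = y^{−1} = y^0 ∈ ℝ^{d_y}, and for k ≥ 0: y_m^k = y^k + θ(y^k − y^{k−1}), x_g^k = τ_x x^k + (1 − τ_x) x_f^k, y_g^k = τ_y y^k + (1 − τ_y) y_f^k, x^{k+1} = x^k + η_x α_x (x_g^k − x^k) − η_x β_x Aᵀ(A x^k − s_g(y_g^k)) − η_x (s_f(x_g^k) + Aᵀ y_m^k), y^{k+1} = y^k + η_y α_y (y_g^k − y^k)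 − η_y β_y A(Aᵀ y^k + s_f(x_g^k)) − η_y (s_g(y_g^k) − A x^{k+1}), x_f^{k+1} = x_g^k + σ_x (x^{k+1} − x^k), y_f^{k+1} = y_g^k + σ_y (y^{k+1} − y^k). Let Ψ⁰ = (1/η_x)‖x^0 − x*‖² + (1/η_y)‖y^0 − y*‖² + (2/σ_x) B_f(x^0, x*) + (2/σ_y) B_g(y^0, y*). Then for every k ≥ 0: ‖x^k − x*‖² ≤ (1/(3L_{xy}))√(μ_y/μ_x)·( θ^k Ψ⁰ + (4/(1 − θ)²)(δ_x + δ_y) ), ‖y^k − y*‖² ≤ (1/(4L_{xy}))√(μ_x/μ_y)·( θ^k Ψ⁰ + (4/(1 − θ)²)(δ_x + δ_y) ), and 1/(1 − θ) ≤ 4 + 4 max{ √(L_x/μ_x), √(L_y/μ_y), L_{xy}/√(μ_x μ_y) }. -/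
open ContinuousLinearMap
open scoped RealInnerProductSpace

noncomputable section

theorem neg_two_inner_add_sub_le {E : Type*} [NormedAddCommGroup E] [InnerProductSpace ℝ E]
    (a b t : E) : -2 * ⟪a + b, b - t⟫ ≤ ‖a‖ ^ 2 - ‖b‖ ^ 2 + ‖t‖ ^ 2 := by
  have h : 0 ≤ ‖a + b - t‖ ^ 2 := sq_nonneg _
  rw [norm_sub_sq_real, norm_add_sq_real, inner_add_left] at h
  rw [inner_add_left, inner_sub_right, inner_sub_right, real_inner_self_eq_norm_sq]
  linarith

/-- Subtracting the linearization at `v` turns a model of `h` into a model of `breg h · v`. -/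
theorem IsModel.breg {d : ℕ} {h : EuclideanSpace ℝ (Fin d) → ℝ} {x s : EuclideanSpace ℝ (Fin d)}
    {δ L μ c : ℝ} (hm : IsModel h x δ L μ c s) (v : EuclideanSpace ℝ (Fin d)) :
    IsModel (fun z => _root_.breg h z v) x δ L μ (c - h v - ⟪gradient h v, x - v⟫)
      (s - gradient h v) := by
  intro z
  have e : _root_.breg h z v - (c - h v - ⟪gradient h v, x - v⟫) - ⟪s - gradient h v, z - x⟫
      = h z - c - ⟪s, z - x⟫ := by
    simp only [_root_.breg, inner_sub_left, inner_sub_right]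
    ring
  have := hm z
  simp only [e]
  exact this

/-- A model of a nonnegative function has a small slope. -/
theorem IsModel.norm_sq_le {d : ℕ} {φ : EuclideanSpace ℝ (Fin d) → ℝ}
    {x p : EuclideanSpace ℝ (Fin d)} {δ L μ c : ℝ} (hm : IsModel φ x δ L μ c p) (hL : 0 < L)
    (hφ : ∀ z, 0 ≤ φ z) : ‖p‖ ^ 2 ≤ 2 * L * (c + δ) := by
  have h := (hm (x - L⁻¹ • p)).2
  have h0 := hφ (x - L⁻¹ • p)
  have e : x - L⁻¹ • p - x = -(L⁻¹ • p) := by abel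
  rw [e, inner_neg_right, inner_smul_right, real_inner_self_eq_norm_sq, norm_neg, norm_smul,
    Real.norm_of_nonneg (inv_nonneg.2 hL.le)] at h
  have e2 : L / 2 * (L⁻¹ * ‖p‖) ^ 2 = L⁻¹ * ‖p‖ ^ 2 / 2 := by field_simp
  rw [e2] at h
  have h3 : L⁻¹ * ‖p‖ ^ 2 ≤ 2 * (c + δ) := by linarith
  rw [inv_mul_le_iff₀ hL] at h3
  linarith

/-- One step of the inexact accelerated gradient method for one of the two blocks. -/
theorem block_step {m n : ℕ} {φ : EuclideanSpace ℝ (Fin m) → ℝ}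
    (B : EuclideanSpace ℝ (Fin m) →L[ℝ] EuclideanSpace ℝ (Fin n))
    {x x' u u' v xs s gs q qs : EuclideanSpace ℝ (Fin m)} {r : EuclideanSpace ℝ (Fin n)}
    {δ L μ c η β σ τ M : ℝ} (hL : 0 < L) (hμ : 0 < μ) (hη : 0 < η) (hβ : 0 < β)
    (hσ : 0 < σ) (hσ1 : σ ≤ 1) (hτ : τ = (σ⁻¹ + 1 / 2)⁻¹)
    (hηle : η ≤ 1 / (4 * (μ + L * σ))) (hβle : β * M ^ 2 ≤ 1 / (2 * η))
    (hB : ∀ z, ‖B z‖ ≤ M * ‖z‖)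
    (hm : IsModel φ v δ L μ c (s - gs)) (hφ : φ xs = 0) (hopt : gs + qs = 0)
    (hv : v = τ • x + (1 - τ) • u)
    (hstep : x' = x + (η * μ) • (v - x) - (η * β) • (adjoint B) (B x - r) - η • (s + q))
    (hu' : u' = v + σ • (x' - x)) :
    1 / η * ‖x' - xs‖ ^ 2 + 2 / σ * φ u' ≤
      (1 / η - μ) * ‖x - xs‖ ^ 2 - 1 / (4 * η) * ‖x' - x‖ ^ 2 + (2 / σ - 1) * φ u
        + 2 / σ * δ - c + β * ‖r - B xs‖ ^ 2 - 2 * ⟪q - qs, x' - xs⟫ := by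
  have hσ' : σ ≠ 0 := hσ.ne'
  have hη' : η ≠ 0 := hη.ne'
  have hτ0 : τ * (σ⁻¹ + 1 / 2) = 1 := by
    rw [hτ]; exact inv_mul_cancel₀ (by positivity)
  have hsplit : x' - xs = (x' - x) + (x - xs) := by abel
  -- expansion of the squared distance
  have hexp : 1 / η * ‖x' - xs‖ ^ 2 = 1 / η * ‖x - xs‖ ^ 2
      + 2 * (1 / η * ⟪x' - x, x' - xs⟫) - 1 / η * ‖x' - x‖ ^ 2 := by
    have : ‖x - xs‖ ^ 2 = ‖x' - xs‖ ^ 2 - 2 * ⟪x' - x, x' - xs⟫ + ‖x' - x‖ ^ 2 := by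
      rw [show x - xs = (x' - xs) - (x' - x) by abel, norm_sub_sq_real,
        real_inner_comm]
    rw [this]; ring
  have hdir : 1 / η * ⟪x' - x, x' - xs⟫ = μ * ⟪v - x, x' - xs⟫
      - β * ⟪B (x' - xs), B x - r⟫ - ⟪s - gs, x' - xs⟫ - ⟪q - qs, x' - xs⟫ := by
    have e : x' - x = η • (μ • (v - x) - β • (adjoint B) (B x - r)
        - ((s - gs) + (q - qs))) := by
      have e1 : (s - gs) + (q - qs) = s + q := by
        rw [← sub_zero (s + q), ← hopt]; abel
      rw [e1, hstep]; module
    rw [e, real_inner_smul_left, inner_sub_left, inner_sub_left, inner_add_left,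
      real_inner_smul_left, real_inner_smul_left, adjoint_inner_left, real_inner_comm (B x - r)]
    field_simp
    ring
  have h1 : 2 * ⟪v - x, x' - xs⟫ ≤ ‖x' - x‖ ^ 2 - ‖x - xs‖ ^ 2 + ‖v - xs‖ ^ 2 := by
    have h := neg_two_inner_add_sub_le (x' - x) (x - xs) (v - xs)
    rw [← hsplit, show x - xs - (v - xs) = -(v - x) by abel, inner_neg_right,
      real_inner_comm] at h
    linarith
  have h2 : -2 * ⟪B (x' - xs), B x - r⟫ ≤ M ^ 2 * ‖x' - x‖ ^ 2 + ‖r - B xs‖ ^ 2 := by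
    have h := neg_two_inner_add_sub_le (B (x' - x)) (B (x - xs)) (r - B xs)
    rw [← map_add, ← hsplit, show B (x - xs) - (r - B xs) = B x - r by
      rw [map_sub]; abel] at h
    have hB2 : ‖B (x' - x)‖ ^ 2 ≤ (M * ‖x' - x‖) ^ 2 :=
      pow_le_pow_left₀ (norm_nonneg _) (hB _) 2
    nlinarith [sq_nonneg ‖B (x - xs)‖]
  have h3 : ⟪s - gs, x' - xs⟫ = -⟪s - gs, xs - v⟫ - (1 / σ - 1 / 2) * ⟪s - gs, u - v⟫
      + 1 / σ * ⟪s - gs, u' - v⟫ := by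
    have e : x' - xs = -(xs - v) - (1 / σ - 1 / 2) • (u - v) + (1 / σ) • (u' - v) := by
      have e1 : (1 / σ) • (u' - v) = x' - x := by
        rw [hu', add_sub_cancel_left, smul_smul, one_div_mul_cancel hσ', one_smul]
      have e2 : (1 / σ - 1 / 2) • (u - v) = v - x := by
        have e3 : u - v = τ • (u - x) := by rw [hv]; module
        have e4 : v - x = (1 - τ) • (u - x) := by rw [hv]; module
        have e5 : (1 / σ - 1 / 2) * τ = 1 - τ := by
          rw [one_div]; linarith
        rw [e3, e4, smul_smul, e5]
      rw [e1, e2]; abel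
    rw [e, inner_add_right, inner_sub_right, inner_neg_right, real_inner_smul_right,
      real_inner_smul_right]
  -- the model inequalities at the solution and at the two extrapolated points
  have m1 := (hm xs).1
  have m2 := (hm u).1
  have m3 := (hm u').2
  rw [hφ, norm_sub_rev] at m1
  have m2' : ⟪s - gs, u - v⟫ ≤ φ u - c := by
    have : 0 ≤ μ / 2 * ‖u - v‖ ^ 2 := by positivity
    linarith
  have hn : ‖u' - v‖ ^ 2 = σ ^ 2 * ‖x' - x‖ ^ 2 := by
    rw [hu', add_sub_cancel_left, norm_smul, Real.norm_of_nonneg hσ.le, mul_pow]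
  rw [hn] at m3
  have hσ2 : 0 ≤ 2 * (1 / σ - 1 / 2) := by
    have : 1 ≤ 1 / σ := by rwa [le_div_iff₀ hσ, one_mul]
    linarith
  have k2 := mul_le_mul_of_nonneg_left m2' hσ2
  have k3 := mul_le_mul_of_nonneg_left m3 (by positivity : 0 ≤ 2 / σ)
  have hk : 2 / σ * (L / 2 * (σ ^ 2 * ‖x' - x‖ ^ 2) + δ)
      = L * σ * ‖x' - x‖ ^ 2 + 2 / σ * δ := by field_simp
  rw [hk] at k3
  have k1 := mul_le_mul_of_nonneg_left h1 hμ.le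
  have k4 := mul_le_mul_of_nonneg_left h2 hβ.le
  have hcoef : μ + β * M ^ 2 + L * σ - 1 / η ≤ -(1 / (4 * η)) := by
    have hpos : 0 < μ + L * σ := by positivity
    have : μ + L * σ ≤ 1 / (4 * η) := by
      rw [le_div_iff₀ (by positivity)] at hηle ⊢
      linarith
    have e1 : 1 / (2 * η) = 2 * (1 / (4 * η)) := by field_simp; norm_num
    have e2 : 1 / η = 4 * (1 / (4 * η)) := by field_simp
    linarith
  have k5 := mul_le_mul_of_nonneg_right hcoef (sq_nonneg ‖x' - x‖)
  have e2 : 2 / σ = 2 * (1 / σ) := by ring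
  rw [hexp, hdir, h3]
  rw [e2] at k3 ⊢
  linarith

theorem inv_le_min_mul {a b μ R : ℝ} (ha : 0 < a) (hb : 0 < b) (hμ : 0 < μ) (h1 : a / μ ≤ R)
    (h2 : b / μ ≤ R) : R⁻¹ ≤ min (1 / a) (1 / b) * μ := by
  rw [min_mul_of_nonneg _ _ hμ.le]
  refine le_min ?_ ?_
  · rw [one_div_mul_eq_div, ← inv_div]
    exact inv_anti₀ (by positivity) h1
  · rw [one_div_mul_eq_div, ← inv_div]
    exact inv_anti₀ (by positivity) h2

theorem two_mul_inner_le {E F : Type*} [NormedAddCommGroup E] [InnerProductSpace ℝ E]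
    [NormedAddCommGroup F] [InnerProductSpace ℝ F] {A : E →L[ℝ] F} {M a b : ℝ}
    (ha : 0 < a) (hb : 0 < b) (hab : 16 * (a * b * M ^ 2) ≤ 1)
    (hA : ∀ v, ‖A v‖ ≤ M * ‖v‖) (u : E) (v : F) :
    |2 * ⟪A u, v⟫| ≤ 1 / (4 * a) * ‖u‖ ^ 2 + 1 / (4 * b) * ‖v‖ ^ 2 := by
  have h1 : |⟪A u, v⟫| ≤ M * ‖u‖ * ‖v‖ :=
    (abs_real_inner_le_norm _ _).trans (mul_le_mul_of_nonneg_right (hA u) (norm_nonneg v))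
  have h2 : 2 * (M * ‖u‖ * ‖v‖) ≤ 1 / (4 * a) * ‖u‖ ^ 2 + 4 * a * M ^ 2 * ‖v‖ ^ 2 := by
    have h := sq_nonneg (‖u‖ - 4 * a * M * ‖v‖)
    have e : 1 / (4 * a) * ‖u‖ ^ 2 + 4 * a * M ^ 2 * ‖v‖ ^ 2 - 2 * (M * ‖u‖ * ‖v‖)
        = 1 / (4 * a) * (‖u‖ - 4 * a * M * ‖v‖) ^ 2 := by
      field_simp; ring
    have : 0 ≤ 1 / (4 * a) * (‖u‖ - 4 * a * M * ‖v‖) ^ 2 := by positivity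
    linarith
  have h3 : 4 * a * M ^ 2 ≤ 1 / (4 * b) := by
    rw [le_div_iff₀ (by positivity)]
    linarith
  have h4 := mul_le_mul_of_nonneg_right h3 (sq_nonneg ‖v‖)
  rw [abs_mul, abs_two]
  linarith

theorem geometric_recursion {Ψ : ℕ → ℝ} {θ R D : ℝ} (hθ : 0 ≤ θ) (hR : 0 < R) (hθR : θ = 1 - R⁻¹)
    (hΨ : ∀ k, Ψ (k + 1) ≤ θ * Ψ k + D) (hD : 0 ≤ D) (k : ℕ) : Ψ k ≤ θ ^ k * Ψ 0 + R * D := by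
  induction k with
  | zero =>
    have := mul_nonneg hR.le hD
    simpa using this
  | succ k ih =>
    have h := mul_le_mul_of_nonneg_left ih hθ
    have e : θ * (R * D) = R * D - D := by
      rw [hθR]; field_simp
    rw [pow_succ]
    linarith [hΨ k]

theorem condition_le {L μ σ M : ℝ} (hμ : 0 < μ) (hL : 0 < L)
    (hσ : σ = Real.sqrt (μ / (2 * L))) (hle : Real.sqrt (L / μ) ≤ M) :
    4 * (μ + L * σ) / μ ≤ 4 + 4 * M ∧ 2 / σ ≤ 4 + 4 * M := by
  have ht0 : 0 < Real.sqrt (L / μ) := by positivity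
  have ht2 : Real.sqrt (L / μ) ^ 2 = L / μ := Real.sq_sqrt (by positivity)
  generalize Real.sqrt (L / μ) = t at hle ht0 ht2
  have hσ0 : 0 < σ := by rw [hσ]; positivity
  have hσ2 : σ ^ 2 = μ / (2 * L) := by rw [hσ]; exact Real.sq_sqrt (by positivity)
  have hp : (σ * t) ^ 2 = 1 / 2 := by rw [mul_pow, hσ2, ht2]; field_simp
  have hp0 : 0 < σ * t := by positivity
  have hp1 : σ * t ≤ 1 := by nlinarith
  have hp2 : 1 / 2 ≤ σ * t := by nlinarith
  constructor
  · have e : 4 * (μ + L * σ) / μ = 4 + 4 * (t ^ 2 * σ) := by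
      rw [ht2]; field_simp
    have := mul_le_mul_of_nonneg_left hp1 ht0.le
    rw [e]; linarith
  · have : 2 / σ ≤ 4 * t := by
      rw [div_le_iff₀ hσ0]; linarith
    linarith

theorem stmt12 {dx dy : ℕ}
    (f : EuclideanSpace ℝ (Fin dx) → ℝ) (g : EuclideanSpace ℝ (Fin dy) → ℝ)
    (hfdiff : ∀ z, DifferentiableAt ℝ f z) (hgdiff : ∀ z, DifferentiableAt ℝ g z)
    (Lx Ly μx μy : ℝ) (hμx : 0 < μx) (hμxLx : μx ≤ Lx) (hμy : 0 < μy) (hμyLy : μy ≤ Ly)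
    (hfsmooth : ∀ x y, ‖gradient f y - gradient f x‖ ≤ Lx * ‖y - x‖)
    (hfsc : ∀ x y, f y ≥ f x + ⟪gradient f x, y - x⟫ + μx / 2 * ‖y - x‖ ^ 2)
    (hgsmooth : ∀ x y, ‖gradient g y - gradient g x‖ ≤ Ly * ‖y - x‖)
    (hgsc : ∀ x y, g y ≥ g x + ⟪gradient g x, y - x⟫ + μy / 2 * ‖y - x‖ ^ 2)
    (A : EuclideanSpace ℝ (Fin dx) →L[ℝ] EuclideanSpace ℝ (Fin dy))
    (Lxy : ℝ) (hLxy : 0 < Lxy) (hA : ∀ v, ‖A v‖ ≤ Lxy * ‖v‖)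
    (xstar : EuclideanSpace ℝ (Fin dx)) (ystar : EuclideanSpace ℝ (Fin dy))
    (hopt1 : gradient f xstar + adjoint A ystar = 0)
    (hopt2 : gradient g ystar = A xstar)
    (δx δy : ℝ) (hδx : 0 ≤ δx) (hδy : 0 ≤ δy)
    (cf : EuclideanSpace ℝ (Fin dx) → ℝ) (sf : EuclideanSpace ℝ (Fin dx) → EuclideanSpace ℝ (Fin dx))
    (cg : EuclideanSpace ℝ (Fin dy) → ℝ) (sg : EuclideanSpace ℝ (Fin dy) → EuclideanSpace ℝ (Fin dy))
    (hmodf : ∀ x, IsModel f x δx Lx μx (cf x) (sf x))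
    (hmodg : ∀ y, IsModel g y δy Ly μy (cg y) (sg y))
    (w σx σy τx τy αx αy ηx ηy βx βy θ : ℝ)
    (hw : w = Real.sqrt (μy / μx))
    (hσx : σx = Real.sqrt (μx / (2 * Lx))) (hσy : σy = Real.sqrt (μy / (2 * Ly)))
    (hτx : τx = (σx⁻¹ + 1 / 2)⁻¹) (hτy : τy = (σy⁻¹ + 1 / 2)⁻¹)
    (hαx : αx = μx) (hαy : αy = μy)
    (hηx : ηx = min (1 / (4 * (μx + Lx * σx))) (w / (4 * Lxy)))
    (hηy : ηy = min (1 / (4 * (μy + Ly * σy))) (1 / (4 * Lxy * w)))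
    (hβx : βx = min (1 / (2 * Ly)) (1 / (2 * ηx * Lxy ^ 2)))
    (hβy : βy = min (1 / (2 * Lx)) (1 / (2 * ηy * Lxy ^ 2)))
    (hθ : θ = 1 - (max (4 * (μx + Lx * σx) / μx) (max (2 / σx)
        (max (4 * (μy + Ly * σy) / μy) (max (2 / σy)
        (max (4 * Lxy / (μx * w)) (4 * Lxy * w / μy))))))⁻¹)
    -- the sequences of the algorithm; `yprev k` plays the role of `y^{k-1}` with `y^{-1} = y^0`
    (x xf xg : ℕ → EuclideanSpace ℝ (Fin dx))
    (y yprev yf yg ym : ℕ → EuclideanSpace ℝ (Fin dy))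
    (hxf0 : xf 0 = x 0) (hyf0 : yf 0 = y 0)
    (hyprev0 : yprev 0 = y 0) (hyprev : ∀ k, yprev (k + 1) = y k)
    (hym : ∀ k, ym k = y k + θ • (y k - yprev k))
    (hxg : ∀ k, xg k = τx • x k + (1 - τx) • xf k)
    (hyg : ∀ k, yg k = τy • y k + (1 - τy) • yf k)
    (hxstep : ∀ k, x (k + 1) = x k + (ηx * αx) • (xg k - x k)
        - (ηx * βx) • (adjoint A) (A (x k) - sg (yg k))
        - ηx • (sf (xg k) + (adjoint A) (ym k)))
    (hystep : ∀ k, y (k + 1) = y k + (ηy * αy) • (yg k - y k)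
        - (ηy * βy) • A ((adjoint A) (y k) + sf (xg k))
        - ηy • (sg (yg k) - A (x (k + 1))))
    (hxfstep : ∀ k, xf (k + 1) = xg k + σx • (x (k + 1) - x k))
    (hyfstep : ∀ k, yf (k + 1) = yg k + σy • (y (k + 1) - y k))
    (Ψ0 : ℝ)
    (hΨ0 : Ψ0 = (1 / ηx) * ‖x 0 - xstar‖ ^ 2 + (1 / ηy) * ‖y 0 - ystar‖ ^ 2
        + (2 / σx) * breg f (x 0) xstar + (2 / σy) * breg g (y 0) ystar) :
    (∀ k : ℕ, ‖x k - xstar‖ ^ 2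
        ≤ 1 / (3 * Lxy) * Real.sqrt (μy / μx)
          * (θ ^ k * Ψ0 + 4 / (1 - θ) ^ 2 * (δx + δy))) ∧
    (∀ k : ℕ, ‖y k - ystar‖ ^ 2
        ≤ 1 / (4 * Lxy) * Real.sqrt (μx / μy)
          * (θ ^ k * Ψ0 + 4 / (1 - θ) ^ 2 * (δx + δy))) ∧
    1 / (1 - θ) ≤ 4 + 4 * max (Real.sqrt (Lx / μx))
        (max (Real.sqrt (Ly / μy)) (Lxy / Real.sqrt (μx * μy))) := by
  have hLx : 0 < Lx := hμx.trans_le hμxLx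
  have hLy : 0 < Ly := hμy.trans_le hμyLy
  have hw0 : 0 < w := by rw [hw]; positivity
  have hσx0 : 0 < σx := by rw [hσx]; positivity
  have hσy0 : 0 < σy := by rw [hσy]; positivity
  have hσx1 : σx ≤ 1 := by
    rw [hσx, Real.sqrt_le_iff, one_pow, div_le_one (by positivity)]
    refine ⟨zero_le_one, ?_⟩
    linarith
  have hσy1 : σy ≤ 1 := by
    rw [hσy, Real.sqrt_le_iff, one_pow, div_le_one (by positivity)]
    refine ⟨zero_le_one, ?_⟩
    linarith
  have hηx0 : 0 < ηx := by rw [hηx]; positivity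
  have hηy0 : 0 < ηy := by rw [hηy]; positivity
  have hβx0 : 0 < βx := by rw [hβx]; positivity
  have hβy0 : 0 < βy := by rw [hβy]; positivity
  have hηx1 : ηx ≤ 1 / (4 * (μx + Lx * σx)) := hηx ▸ min_le_left _ _
  have hηx2 : ηx ≤ w / (4 * Lxy) := hηx ▸ min_le_right _ _
  have hηy1 : ηy ≤ 1 / (4 * (μy + Ly * σy)) := hηy ▸ min_le_left _ _
  have hηy2 : ηy ≤ 1 / (4 * Lxy * w) := hηy ▸ min_le_right _ _
  have hβx1 : βx * (2 * Ly) ≤ 1 := by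
    rw [← le_div_iff₀ (by positivity)]; exact hβx ▸ min_le_left _ _
  have hβy1 : βy * (2 * Lx) ≤ 1 := by
    rw [← le_div_iff₀ (by positivity)]; exact hβy ▸ min_le_left _ _
  have hβx2 : βx * Lxy ^ 2 ≤ 1 / (2 * ηx) := by
    have h : βx ≤ 1 / (2 * ηx * Lxy ^ 2) := hβx ▸ min_le_right _ _
    rw [le_div_iff₀ (by positivity)] at h ⊢
    linarith
  have hβy2 : βy * Lxy ^ 2 ≤ 1 / (2 * ηy) := by
    have h : βy ≤ 1 / (2 * ηy * Lxy ^ 2) := hβy ▸ min_le_right _ _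
    rw [le_div_iff₀ (by positivity)] at h ⊢
    linarith
  have hηxy : 16 * (ηx * ηy * Lxy ^ 2) ≤ 1 := by
    have h := mul_le_mul hηx2 hηy2 hηy0.le (by positivity)
    have e : w / (4 * Lxy) * (1 / (4 * Lxy * w)) = 1 / (16 * Lxy ^ 2) := by field_simp; norm_num
    rw [e, le_div_iff₀ (by positivity)] at h
    linarith
  -- the contraction factor
  set R := max (4 * (μx + Lx * σx) / μx) (max (2 / σx)
        (max (4 * (μy + Ly * σy) / μy) (max (2 / σy)
        (max (4 * Lxy / (μx * w)) (4 * Lxy * w / μy))))) with hR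
  have hRle := hR.ge
  simp only [max_le_iff] at hRle
  obtain ⟨hR1, hR2, hR3, hR4, hR5, hR6⟩ := hRle
  have hRone : 1 ≤ R := by
    refine le_trans ?_ hR2
    rw [le_div_iff₀ hσx0]; linarith
  have hR0 : 0 < R := by linarith
  have hRinv : 1 - θ = R⁻¹ := by rw [hθ]; ring
  have hθ0 : 0 ≤ θ := by
    have : R⁻¹ ≤ 1 := inv_le_one_of_one_le₀ hRone
    linarith
  have hθ1 : θ ≤ 1 := by
    have : 0 < R⁻¹ := inv_pos.2 hR0
    linarith
  have hcx : 1 / ηx - μx ≤ θ * (1 / ηx) := by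
    have h : R⁻¹ ≤ ηx * μx := by
      rw [hηx, show w / (4 * Lxy) = 1 / (4 * Lxy / w) by rw [one_div_div]]
      refine inv_le_min_mul (by positivity) (by positivity) hμx hR1 ?_
      rwa [div_div, mul_comm w]
    have h2 : R⁻¹ * (1 / ηx) ≤ μx := by
      rw [mul_one_div, div_le_iff₀ hηx0]; linarith
    rw [hθ]; linarith
  have hcy : 1 / ηy - μy ≤ θ * (1 / ηy) := by
    have h : R⁻¹ ≤ ηy * μy := by
      rw [hηy]
      exact inv_le_min_mul (by positivity) (by positivity) hμy hR3 hR6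
    have h2 : R⁻¹ * (1 / ηy) ≤ μy := by
      rw [mul_one_div, div_le_iff₀ hηy0]; linarith
    rw [hθ]; linarith
  have hcσ : ∀ σ : ℝ, 0 < σ → 2 / σ ≤ R → 2 / σ - 1 ≤ θ * (2 / σ) := by
    intro σ hσ h
    have h2 : R⁻¹ * (2 / σ) ≤ 1 := by
      rw [inv_mul_le_iff₀ hR0]; linarith
    rw [hθ]; linarith
  -- Bregman divergences to the solution
  have hφ0 : ∀ z, 0 ≤ breg f z xstar := fun z => by
    have h := hfsc xstar z
    have : 0 ≤ μx / 2 * ‖z - xstar‖ ^ 2 := by positivity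
    unfold breg; linarith
  have hψ0 : ∀ z, 0 ≤ breg g z ystar := fun z => by
    have h := hgsc ystar z
    have : 0 ≤ μy / 2 * ‖z - ystar‖ ^ 2 := by positivity
    unfold breg; linarith
  have hφs : breg f xstar xstar = 0 := by simp [breg]
  have hψs : breg g ystar ystar = 0 := by simp [breg]
  have hAadj : ∀ v, ‖adjoint A v‖ ≤ Lxy * ‖v‖ := fun v =>
    (le_opNorm _ v).trans (mul_le_mul_of_nonneg_right
      ((LinearIsometryEquiv.norm_map adjoint A).trans_le (opNorm_le_bound A hLxy.le hA))
      (norm_nonneg v))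
  -- the Lyapunov function
  let Ψ : ℕ → ℝ := fun k => (1 / ηx) * ‖x k - xstar‖ ^ 2 + (1 / ηy) * ‖y k - ystar‖ ^ 2
    + (2 / σx) * breg f (xf k) xstar + (2 / σy) * breg g (yf k) ystar
    + 1 / (4 * ηy) * ‖y k - yprev k‖ ^ 2 - 2 * ⟪A (x k - xstar), y k - yprev k⟫
  have hΨstep : ∀ k, Ψ (k + 1) ≤ θ * Ψ k + 2 * R * (δx + δy) := by
    intro k
    have mf := (hmodf (xg k)).breg xstar
    have mg := (hmodg (yg k)).breg ystar
    have nf := mf.norm_sq_le hLx hφ0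
    have ng := mg.norm_sq_le hLy hψ0
    have bx := block_step A hLx hμx hηx0 hβx0 hσx0 hσx1 hτx hηx1 hβx2 hA mf hφs hopt1
      (hxg k) (hαx ▸ hxstep k) (hxfstep k)
    have hys : y (k + 1) = y k + (ηy * μy) • (yg k - y k)
        - (ηy * βy) • (adjoint (adjoint A)) ((adjoint A) (y k) - -sf (xg k))
        - ηy • (sg (yg k) + -A (x (k + 1))) := by
      rw [adjoint_adjoint, sub_neg_eq_add, ← sub_eq_add_neg, ← hαy]
      exact hystep k
    have bdual := block_step (adjoint A) hLy hμy hηy0 hβy0 hσy0 hσy1 hτy hηy1 hβy2 hAadj mg hψs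
      (qs := -A xstar) (by rw [hopt2]; abel) (hyg k) hys (hyfstep k)
    rw [← hopt2] at bx
    have er : -sf (xg k) - adjoint A ystar = -(sf (xg k) - gradient f xstar) := by
      rw [eq_neg_of_add_eq_zero_right hopt1]; abel
    rw [er, norm_neg] at bdual
    generalize cf (xg k) - f xstar - ⟪gradient f xstar, xg k - xstar⟫ = c1 at *
    generalize cg (yg k) - g ystar - ⟪gradient g ystar, yg k - ystar⟫ = c2 at *
    have tx : βx * ‖sg (yg k) - gradient g ystar‖ ^ 2 ≤ c2 + δy := by
      have h0 : 0 ≤ c2 + δy := by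
        have := (sq_nonneg _).trans ng
        exact nonneg_of_mul_nonneg_right this (by positivity)
      have h1 := mul_le_mul_of_nonneg_left ng hβx0.le
      have h2 := mul_le_mul_of_nonneg_right hβx1 h0
      linarith
    have ty : βy * ‖sf (xg k) - gradient f xstar‖ ^ 2 ≤ c1 + δx := by
      have h0 : 0 ≤ c1 + δx := by
        have := (sq_nonneg _).trans nf
        exact nonneg_of_mul_nonneg_right this (by positivity)
      have h1 := mul_le_mul_of_nonneg_left nf hβy0.le
      have h2 := mul_le_mul_of_nonneg_right hβy1 h0
      linarith
    -- the bilinear coupling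
    have hcoup : - 2 * ⟪adjoint A (ym k) - adjoint A ystar, x (k + 1) - xstar⟫
        - 2 * ⟪-A (x (k + 1)) - -A xstar, y (k + 1) - ystar⟫
        = 2 * ⟪A (x (k + 1) - xstar), y (k + 1) - y k⟫
          - θ * (2 * ⟪A (x k - xstar), y k - yprev k⟫)
          - θ * (2 * ⟪A (x (k + 1) - x k), y k - yprev k⟫) := by
      rw [← map_sub, adjoint_inner_left, real_inner_comm, hym,
        show -A (x (k + 1)) - -A xstar = -A (x (k + 1) - xstar) by rw [map_sub]; abel]
      simp only [map_sub, inner_sub_left, inner_sub_right, inner_add_right, inner_neg_left,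
        real_inner_smul_right]
      ring
    have hyoung := (abs_le.1 (two_mul_inner_le hηx0 hηy0 hηxy hA
      (x (k + 1) - x k) (y k - yprev k))).1
    have hy1 := mul_le_mul_of_nonneg_left hyoung hθ0
    have hy2 : θ * (1 / (4 * ηx) * ‖x (k + 1) - x k‖ ^ 2)
        ≤ 1 / (4 * ηx) * ‖x (k + 1) - x k‖ ^ 2 :=
      mul_le_of_le_one_left (by positivity) hθ1
    have k1 := mul_le_mul_of_nonneg_right hcx (sq_nonneg ‖x k - xstar‖)
    have k2 := mul_le_mul_of_nonneg_right hcy (sq_nonneg ‖y k - ystar‖)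
    have k3 := mul_le_mul_of_nonneg_right (hcσ σx hσx0 hR2) (hφ0 (xf k))
    have k4 := mul_le_mul_of_nonneg_right (hcσ σy hσy0 hR4) (hψ0 (yf k))
    have k5 := mul_le_mul_of_nonneg_right (show 2 / σx + 1 ≤ 2 * R by linarith) hδx
    have k6 := mul_le_mul_of_nonneg_right (show 2 / σy + 1 ≤ 2 * R by linarith) hδy
    simp only [Ψ, hyprev]
    linarith
  have hΨ00 : Ψ 0 = Ψ0 := by simp [Ψ, hΨ0, hyprev0, hxf0, hyf0]
  have hbound : ∀ k, Ψ k ≤ θ ^ k * Ψ0 + 4 / (1 - θ) ^ 2 * (δx + δy) := by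
    intro k
    have h := geometric_recursion hθ0 hR0 hθ hΨstep (by positivity) k
    have e : 4 / (1 - θ) ^ 2 = 4 * R ^ 2 := by
      rw [hRinv]; field_simp
    rw [hΨ00] at h
    rw [e]
    have : 0 ≤ R ^ 2 * (δx + δy) := by positivity
    linarith
  have hlower : ∀ k, 3 / (4 * ηx) * ‖x k - xstar‖ ^ 2 + 1 / ηy * ‖y k - ystar‖ ^ 2
      ≤ θ ^ k * Ψ0 + 4 / (1 - θ) ^ 2 * (δx + δy) := by
    intro k
    refine le_trans ?_ (hbound k)
    have h := (abs_le.1 (two_mul_inner_le hηx0 hηy0 hηxy hA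
      (x k - xstar) (y k - yprev k))).2
    have h1 : 0 ≤ (2 / σx) * breg f (xf k) xstar := mul_nonneg (by positivity) (hφ0 _)
    have h2 : 0 ≤ (2 / σy) * breg g (yf k) ystar := mul_nonneg (by positivity) (hψ0 _)
    have e1 : 1 / ηx = 3 / (4 * ηx) + 1 / (4 * ηx) := by field_simp; norm_num
    simp only [Ψ]
    rw [e1]
    linarith
  refine ⟨fun k => ?_, fun k => ?_, ?_⟩
  · have h1 : 3 / (4 * ηx) * ‖x k - xstar‖ ^ 2
        ≤ θ ^ k * Ψ0 + 4 / (1 - θ) ^ 2 * (δx + δy) := by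
      have : 0 ≤ 1 / ηy * ‖y k - ystar‖ ^ 2 := by positivity
      linarith [hlower k]
    have h0 : 0 ≤ 3 / (4 * ηx) * ‖x k - xstar‖ ^ 2 := by positivity
    have h2 : 4 * ηx / 3 ≤ 1 / (3 * Lxy) * w := by
      rw [le_div_iff₀ (by positivity)] at hηx2
      rw [one_div_mul_eq_div, le_div_iff₀ (by positivity)]
      linarith
    rw [← hw]
    calc ‖x k - xstar‖ ^ 2 = 4 * ηx / 3 * (3 / (4 * ηx) * ‖x k - xstar‖ ^ 2) := by field_simp
      _ ≤ _ := mul_le_mul h2 h1 h0 (by positivity)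
  · have h1 : 1 / ηy * ‖y k - ystar‖ ^ 2
        ≤ θ ^ k * Ψ0 + 4 / (1 - θ) ^ 2 * (δx + δy) := by
      have : 0 ≤ 3 / (4 * ηx) * ‖x k - xstar‖ ^ 2 := by positivity
      linarith [hlower k]
    have h0 : 0 ≤ 1 / ηy * ‖y k - ystar‖ ^ 2 := by positivity
    have hw' : Real.sqrt (μx / μy) = 1 / w := by
      rw [hw, ← inv_div, Real.sqrt_inv, one_div]
    have h2 : ηy ≤ 1 / (4 * Lxy) * (1 / w) := by
      rwa [div_mul_div_comm, one_mul]
    rw [hw']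
    calc ‖y k - ystar‖ ^ 2 = ηy * (1 / ηy * ‖y k - ystar‖ ^ 2) := by field_simp
      _ ≤ _ := mul_le_mul h2 h1 h0 (by positivity)
  · rw [hRinv, one_div, inv_inv]
    set M := max (Real.sqrt (Lx / μx)) (max (Real.sqrt (Ly / μy)) (Lxy / Real.sqrt (μx * μy)))
      with hM
    have hMle := hM.ge
    simp only [max_le_iff] at hMle
    obtain ⟨hM1, hM2, hM3⟩ := hMle
    obtain ⟨d1, d2⟩ := condition_le hμx hLx hσx hM1
    obtain ⟨d3, d4⟩ := condition_le hμy hLy hσy hM2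
    have hsx : Real.sqrt μx ^ 2 = μx := Real.sq_sqrt hμx.le
    have hsy : Real.sqrt μy ^ 2 = μy := Real.sq_sqrt hμy.le
    have hsx0 : 0 < Real.sqrt μx := Real.sqrt_pos.2 hμx
    have hsy0 : 0 < Real.sqrt μy := Real.sqrt_pos.2 hμy
    have hw' : w = Real.sqrt μy / Real.sqrt μx := by rw [hw, Real.sqrt_div hμy.le]
    rw [Real.sqrt_mul hμx.le] at hM3
    have d5 : 4 * Lxy / (μx * w) = 4 * (Lxy / (Real.sqrt μx * Real.sqrt μy)) := by
      rw [hw']; nth_rewrite 1 [← hsx]; field_simp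
    have d6 : 4 * Lxy * w / μy = 4 * (Lxy / (Real.sqrt μx * Real.sqrt μy)) := by
      rw [hw']; nth_rewrite 2 [← hsy]; field_simp
    rw [hR]
    refine max_le d1 (max_le d2 (max_le d3 (max_le d4 (max_le ?_ ?_))))
    · rw [d5]; linarith
    · rw [d6]; linarith

end
end

section
/- (Consensus deviation of the auxiliary sequence V^k.) Let d, n ≥ 1, σ_x, τ_x ∈ (0, 1], δ′ ≥ 0, and let (X^k)_{k≥0} be a sequence in ℝ^{d×n} with ‖X^k − X̄^k‖ ≤ √δ′ for all k, where ‖·‖ is the Frobenius norm and X̄ denotes the matrix each of whose columns equals the average of the columns of X. Define V^0 = (1 − σ_x) X^0 and V^k = (1 − σ_x) τ_x X^k + (1 − τ_x) V^{k−1} for k ≥ 1. Then for every k ≥ 0: ‖V^k − V̄^k‖ ≤ (1 − σ_x) √δ′, and consequently for every k ≥ 1 the matrix X_f^k = V^{k−1} + σ_x X^k satisfies ‖X_f^k − X̄_f^k‖ ≤ √δ′. -/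
open scoped BigOperators

noncomputable section

/-- Frobenius norm of a matrix given as `n` columns in `ℝ^d`. -/
def fro {d n : ℕ} (M : Fin n → EuclideanSpace ℝ (Fin d)) : ℝ :=
  Real.sqrt (∑ j, ‖M j‖ ^ 2)

/-- The matrix each of whose columns equals the average of the columns of `M`. -/
def colAvg {d n : ℕ} (M : Fin n → EuclideanSpace ℝ (Fin d)) :
    Fin n → EuclideanSpace ℝ (Fin d) :=
  fun _ => (n : ℝ)⁻¹ • ∑ j, M j

lemma fro_eq_norm_toLp {d n : ℕ} (M : Fin n → EuclideanSpace ℝ (Fin d)) :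
    fro M = ‖WithLp.toLp 2 M‖ := by
  rw [PiLp.norm_eq_of_L2, fro]

lemma fro_add_le {d n : ℕ} (A B : Fin n → EuclideanSpace ℝ (Fin d)) :
    fro (A + B) ≤ fro A + fro B := by
  simp only [fro_eq_norm_toLp, WithLp.toLp_add]
  exact norm_add_le _ _

lemma fro_smul {d n : ℕ} {c : ℝ} (hc : 0 ≤ c) (A : Fin n → EuclideanSpace ℝ (Fin d)) :
    fro (c • A) = c * fro A := by
  simp only [fro_eq_norm_toLp, WithLp.toLp_smul, norm_smul, Real.norm_of_nonneg hc]

lemma colAvg_add {d n : ℕ} (A B : Fin n → EuclideanSpace ℝ (Fin d)) :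
    colAvg (A + B) = colAvg A + colAvg B := by
  funext j
  simp [colAvg, Finset.sum_add_distrib]

lemma colAvg_smul {d n : ℕ} (c : ℝ) (A : Fin n → EuclideanSpace ℝ (Fin d)) :
    colAvg (c • A) = c • colAvg A := by
  funext j
  simp [colAvg, ← Finset.smul_sum, smul_comm c]

/-- The consensus deviation `fro (M - colAvg M)` is subadditive. -/
lemma fro_sub_colAvg_add_le {d n : ℕ} (A B : Fin n → EuclideanSpace ℝ (Fin d)) :
    fro ((A + B) - colAvg (A + B)) ≤ fro (A - colAvg A) + fro (B - colAvg B) := by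
  rw [colAvg_add, add_sub_add_comm]
  exact fro_add_le _ _

/-- The consensus deviation `fro (M - colAvg M)` is positively homogeneous. -/
lemma fro_sub_colAvg_smul {d n : ℕ} {c : ℝ} (hc : 0 ≤ c)
    (A : Fin n → EuclideanSpace ℝ (Fin d)) :
    fro (c • A - colAvg (c • A)) = c * fro (A - colAvg A) := by
  rw [colAvg_smul, ← smul_sub, fro_smul hc]

theorem stmt16 {d n : ℕ} (hd : 1 ≤ d) (hn : 1 ≤ n)
    (σx τx : ℝ) (hσx : σx ∈ Set.Ioc (0 : ℝ) 1) (hτx : τx ∈ Set.Ioc (0 : ℝ) 1)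
    (δ' : ℝ) (hδ' : 0 ≤ δ')
    (X : ℕ → Fin n → EuclideanSpace ℝ (Fin d))
    (hX : ∀ k, fro (X k - colAvg (X k)) ≤ Real.sqrt δ')
    (V : ℕ → Fin n → EuclideanSpace ℝ (Fin d))
    (hV0 : V 0 = (1 - σx) • X 0)
    (hV : ∀ k, V (k + 1) = ((1 - σx) * τx) • X (k + 1) + (1 - τx) • V k) :
    (∀ k, fro (V k - colAvg (V k)) ≤ (1 - σx) * Real.sqrt δ') ∧
    (∀ k, fro ((V k + σx • X (k + 1)) - colAvg (V k + σx • X (k + 1)))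
        ≤ Real.sqrt δ') := by
  obtain ⟨hσ0, hσ1⟩ := hσx
  obtain ⟨hτ0, hτ1⟩ := hτx
  have hσ : 0 ≤ 1 - σx := sub_nonneg.2 hσ1
  have hτ : 0 ≤ 1 - τx := sub_nonneg.2 hτ1
  have hστ : 0 ≤ (1 - σx) * τx := mul_nonneg hσ hτ0.le
  have hVdev : ∀ k, fro (V k - colAvg (V k)) ≤ (1 - σx) * Real.sqrt δ' := by
    intro k
    induction k with
    | zero =>
      rw [hV0, fro_sub_colAvg_smul hσ]
      exact mul_le_mul_of_nonneg_left (hX 0) hσ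
    | succ k ih =>
      rw [hV k]
      refine (fro_sub_colAvg_add_le _ _).trans ?_
      rw [fro_sub_colAvg_smul hστ, fro_sub_colAvg_smul hτ]
      linarith [mul_le_mul_of_nonneg_left (hX (k + 1)) hστ, mul_le_mul_of_nonneg_left ih hτ]
  refine ⟨hVdev, fun k => (fro_sub_colAvg_add_le _ _).trans ?_⟩
  rw [fro_sub_colAvg_smul hσ0.le]
  linarith [hVdev k, mul_le_mul_of_nonneg_left (hX (k + 1)) hσ0.le]

end
end
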